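/- For every integer g ≥ 1, there exists a unique ℂ-algebra automorphism ι of K with ι(x) = x⁻¹ and ι(y) = i·y·x^(−(g+1)) (where i ∈ ℂ is the imaginary unit), and the composition ι ∘ ι is the unique ℂ-algebra automorphism η of K with η(x) = x and η(y) = −y (the hyperelliptic involution). -/

import Mathlib

set_option synthInstance.maxHeartbeats 1000000
set_option maxHeartbeats 1000000

/-- The ideal `(Y² − X^(2g+2) + 1)` in `ℂ[X, Y]`, where `X = X 0` and `Y = X 1`. -/
noncomputable def apolarIdeal (g : ℕ) : Ideal (MvPolynomial (Fin 2) ℂ) :=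
  Ideal.span {MvPolynomial.X 1 ^ 2 - MvPolynomial.X 0 ^ (2 * g + 2) + 1}

/-- The affine coordinate ring `A = ℂ[X, Y] / (Y² − X^(2g+2) + 1)` of the apolar curve. -/
abbrev ApolarA (g : ℕ) : Type := MvPolynomial (Fin 2) ℂ ⧸ apolarIdeal g

/-- The function field `K`, the field of fractions of `A`. -/
abbrev ApolarK (g : ℕ) : Type := FractionRing (ApolarA g)

/-- The image `x` of `X` in `K`. -/
noncomputable def ax (g : ℕ) : ApolarK g :=
  algebraMap (ApolarA g) (ApolarK g) (Ideal.Quotient.mk (apolarIdeal g) (MvPolynomial.X 0))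

/-- The image `y` of `Y` in `K`. -/
noncomputable def ay (g : ℕ) : ApolarK g :=
  algebraMap (ApolarA g) (ApolarK g) (Ideal.Quotient.mk (apolarIdeal g) (MvPolynomial.X 1))

/-- The `ℂ`-algebra homomorphism out of `A` sending `x` to `a` and `y` to `b`, for a point `(a, b)`
of the curve. -/
noncomputable def apolarLift (g : ℕ) {R : Type*} [CommRing R] [Algebra ℂ R] (a b : R)
    (h : b ^ 2 - a ^ (2 * g + 2) + 1 = 0) : ApolarA g →ₐ[ℂ] R :=
  Ideal.Quotient.liftₐ (apolarIdeal g) (MvPolynomial.aeval ![a, b]) fun p hp ↦ by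
    refine (Ideal.span_singleton_le_iff_mem (RingHom.ker (MvPolynomial.aeval ![a, b]))).2 ?_ hp
    simpa [RingHom.mem_ker] using h

@[simp]
theorem apolarLift_X_zero (g : ℕ) {R : Type*} [CommRing R] [Algebra ℂ R] (a b : R)
    (h : b ^ 2 - a ^ (2 * g + 2) + 1 = 0) :
    apolarLift g a b h (Ideal.Quotient.mk (apolarIdeal g) (MvPolynomial.X 0)) = a :=
  (MvPolynomial.aeval_X _ _).trans rfl

@[simp]
theorem apolarLift_X_one (g : ℕ) {R : Type*} [CommRing R] [Algebra ℂ R] (a b : R)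
    (h : b ^ 2 - a ^ (2 * g + 2) + 1 = 0) :
    apolarLift g a b h (Ideal.Quotient.mk (apolarIdeal g) (MvPolynomial.X 1)) = b :=
  (MvPolynomial.aeval_X _ _).trans rfl

theorem ApolarA.algHom_ext {g : ℕ} {R : Type*} [CommRing R] [Algebra ℂ R]
    {f₁ f₂ : ApolarA g →ₐ[ℂ] R}
    (h₀ : f₁ (Ideal.Quotient.mk (apolarIdeal g) (MvPolynomial.X 0)) =
      f₂ (Ideal.Quotient.mk (apolarIdeal g) (MvPolynomial.X 0)))
    (h₁ : f₁ (Ideal.Quotient.mk (apolarIdeal g) (MvPolynomial.X 1)) =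
      f₂ (Ideal.Quotient.mk (apolarIdeal g) (MvPolynomial.X 1))) : f₁ = f₂ := by
  apply Ideal.Quotient.algHom_ext
  apply MvPolynomial.algHom_ext
  intro i
  fin_cases i
  · exact h₀
  · exact h₁

theorem ApolarK.algHom_ext {g : ℕ} {R : Type*} [CommRing R] [Algebra ℂ R]
    {f₁ f₂ : ApolarK g →ₐ[ℂ] R} (h₀ : f₁ (ax g) = f₂ (ax g)) (h₁ : f₁ (ay g) = f₂ (ay g)) :
    f₁ = f₂ := by
  have h : f₁.comp (IsScalarTower.toAlgHom ℂ (ApolarA g) (ApolarK g)) =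
      f₂.comp (IsScalarTower.toAlgHom ℂ (ApolarA g) (ApolarK g)) :=
    ApolarA.algHom_ext h₀ h₁
  apply AlgHom.coe_ringHom_injective
  apply IsLocalization.ringHom_ext (nonZeroDivisors (ApolarA g))
  exact congrArg AlgHom.toRingHom h

theorem ApolarK.algEquiv_ext {g : ℕ} {e₁ e₂ : ApolarK g ≃ₐ[ℂ] ApolarK g}
    (h₀ : e₁ (ax g) = e₂ (ax g)) (h₁ : e₁ (ay g) = e₂ (ay g)) : e₁ = e₂ :=
  AlgEquiv.coe_toAlgHom_injective (ApolarK.algHom_ext h₀ h₁)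

theorem apolar_equation (g : ℕ) :
    (Ideal.Quotient.mk (apolarIdeal g) (MvPolynomial.X 1)) ^ 2 -
      (Ideal.Quotient.mk (apolarIdeal g) (MvPolynomial.X 0)) ^ (2 * g + 2) + 1 = 0 :=
  Ideal.Quotient.eq_zero_iff_mem.2 (Ideal.mem_span_singleton_self
    (MvPolynomial.X 1 ^ 2 - MvPolynomial.X 0 ^ (2 * g + 2) + 1 : MvPolynomial (Fin 2) ℂ))

theorem ay_sq_sub_ax_pow_add_one (g : ℕ) : ay g ^ 2 - ax g ^ (2 * g + 2) + 1 = 0 := by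
  simpa [ax, ay] using congrArg (algebraMap (ApolarA g) (ApolarK g)) (apolar_equation g)

/-- The hyperelliptic involution of the coordinate ring `A`. -/
noncomputable def apolarNeg (g : ℕ) : ApolarA g →ₐ[ℂ] ApolarA g :=
  apolarLift g (Ideal.Quotient.mk (apolarIdeal g) (MvPolynomial.X 0))
    (-Ideal.Quotient.mk (apolarIdeal g) (MvPolynomial.X 1)) (by
      linear_combination apolar_equation g)

theorem apolarNeg_injective (g : ℕ) : Function.Injective (apolarNeg g) := by
  have h : (apolarNeg g).comp (apolarNeg g) = AlgHom.id ℂ _ := by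
    apply ApolarA.algHom_ext <;> simp [apolarNeg]
  exact Function.LeftInverse.injective (DFunLike.congr_fun h)

theorem algebraMap_I_sq (g : ℕ) : algebraMap ℂ (ApolarK g) Complex.I ^ 2 = -1 := by
  rw [← map_pow, Complex.I_sq, map_neg, map_one]

theorem ax_ne_zero (g : ℕ) : ax g ≠ 0 := by
  intro h
  have h₀ := (map_eq_zero_iff _ (IsFractionRing.injective (ApolarA g) (ApolarK g))).1 h
  have := congrArg (apolarLift g (1 : ℂ) 0 (by simp)) h₀
  simp at this

theorem apolarK_neg_comp_self {g : ℕ} {η : ApolarK g →ₐ[ℂ] ApolarK g}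
    (hη : η (ax g) = ax g ∧ η (ay g) = -ay g) : η.comp η = AlgHom.id ℂ _ := by
  apply ApolarK.algHom_ext <;> simp [hη.1, hη.2]

section

variable (g : ℕ) [IsDomain (ApolarA g)]

theorem ax_zpow_neg : ax g ^ (-(g + 1 : ℤ)) = (ax g ^ (g + 1))⁻¹ := by
  rw [zpow_neg, ← zpow_natCast]; push_cast; rfl

/-- The homomorphism `A → K` with `x ↦ x⁻¹` and `y ↦ i·y·x^(−(g+1))`. -/
noncomputable def apolarInv : ApolarA g →ₐ[ℂ] ApolarK g :=
  apolarLift g (ax g)⁻¹ (algebraMap ℂ (ApolarK g) Complex.I * ay g * ax g ^ (-(g + 1 : ℤ))) (by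
    have hx := ax_ne_zero g
    have hy : ay g ^ 2 = ax g ^ (2 * g + 2) - 1 := by linear_combination ay_sq_sub_ax_pow_add_one g
    rw [ax_zpow_neg, mul_pow, mul_pow, algebraMap_I_sq, hy, inv_pow, inv_pow, ← pow_mul,
      show (g + 1) * 2 = 2 * g + 2 by ring]
    field_simp
    ring)

theorem apolarInv_clear_denominators (a : ApolarA g) : ∃ (n : ℕ) (b : ApolarA g),
    apolarInv g a * ax g ^ n = algebraMap _ _ b ∧
      apolarInv g b * ax g ^ n = algebraMap _ _ (apolarNeg g a) := by
  have hx := ax_ne_zero g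
  have hX : apolarInv g (Ideal.Quotient.mk (apolarIdeal g) (MvPolynomial.X 0)) = (ax g)⁻¹ :=
    apolarLift_X_zero ..
  have hY : apolarInv g (Ideal.Quotient.mk (apolarIdeal g) (MvPolynomial.X 1)) =
      algebraMap ℂ (ApolarK g) Complex.I * ay g * ax g ^ (-(g + 1 : ℤ)) := apolarLift_X_one ..
  obtain ⟨p, rfl⟩ := Ideal.Quotient.mk_surjective a
  induction p using MvPolynomial.induction_on with
  | C c =>
    refine ⟨0, algebraMap ℂ _ c, ?_, ?_⟩
    · rw [pow_zero, mul_one, ← IsScalarTower.algebraMap_apply]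
      exact (apolarInv g).commutes c
    · rw [pow_zero, mul_one, AlgHom.commutes]
      rw [show apolarNeg g (Ideal.Quotient.mk (apolarIdeal g) (MvPolynomial.C c)) =
        algebraMap ℂ _ c from (apolarNeg g).commutes c, ← IsScalarTower.algebraMap_apply]
  | add p q hp hq =>
    obtain ⟨m, b, hb, hb'⟩ := hp
    obtain ⟨n, c, hc, hc'⟩ := hq
    refine ⟨m + n, b * Ideal.Quotient.mk _ (MvPolynomial.X 0) ^ n +
      c * Ideal.Quotient.mk _ (MvPolynomial.X 0) ^ m, ?_, ?_⟩
    · simp only [map_add, map_mul, map_pow, ← hb, ← hc]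
      change _ = _ * ax g ^ n + _ * ax g ^ m
      ring
    · simp only [map_add, map_mul, map_pow, ← hb', ← hc', hX, inv_pow, pow_add]
      field_simp
  | mul_X p i hp =>
    obtain ⟨n, b, hb, hb'⟩ := hp
    fin_cases i
    · refine ⟨n + 1, b, ?_, ?_⟩
      · simp only [map_mul, ← hb, Fin.zero_eta, hX]
        field_simp
        ring
      · simp only [map_mul, ← hb', Fin.zero_eta]
        simp only [apolarNeg, apolarLift_X_zero]
        change _ = _ * ax g
        ring
    · refine ⟨n + (g + 1), b * (algebraMap ℂ _ Complex.I *
        Ideal.Quotient.mk _ (MvPolynomial.X 1)), ?_, ?_⟩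
      · simp only [map_mul, ← hb, Fin.mk_one, hY, ← IsScalarTower.algebraMap_apply]
        change _ = _ * (_ * ay g)
        rw [ax_zpow_neg]
        field_simp
        ring
      · simp only [map_mul, ← hb', Fin.mk_one, hY, AlgHom.commutes]
        simp only [apolarNeg, apolarLift_X_one, map_neg]
        change _ = _ * -ay g
        rw [ax_zpow_neg, pow_add]
        field_simp
        rw [algebraMap_I_sq]
        ring

theorem apolarInv_injective : Function.Injective (apolarInv g) := by
  rw [injective_iff_map_eq_zero]
  intro a ha
  obtain ⟨n, b, hb, hb'⟩ := apolarInv_clear_denominators g a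
  have hinj := IsFractionRing.injective (ApolarA g) (ApolarK g)
  rw [ha, zero_mul, eq_comm, map_eq_zero_iff _ hinj] at hb
  rw [hb, map_zero, zero_mul, eq_comm, map_eq_zero_iff _ hinj] at hb'
  exact (map_eq_zero_iff _ (apolarNeg_injective g)).1 hb'

theorem exists_apolarK_neg : ∃ η : ApolarK g →ₐ[ℂ] ApolarK g,
    η (ax g) = ax g ∧ η (ay g) = -ay g := by
  have h : Function.Injective
      ((IsScalarTower.toAlgHom ℂ (ApolarA g) (ApolarK g)).comp (apolarNeg g)) :=
    (IsFractionRing.injective (ApolarA g) (ApolarK g)).comp (apolarNeg_injective g)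
  refine ⟨IsFractionRing.liftAlgHom h, ?_, ?_⟩
  · refine (IsFractionRing.lift_algebraMap h _).trans ?_
    simp [apolarNeg, ax]
  · refine (IsFractionRing.lift_algebraMap h _).trans ?_
    simp [apolarNeg, ay]

theorem exists_apolarK_inv : ∃ ι : ApolarK g →ₐ[ℂ] ApolarK g,
    ι (ax g) = (ax g)⁻¹ ∧
      ι (ay g) = algebraMap ℂ (ApolarK g) Complex.I * ay g * ax g ^ (-(g + 1 : ℤ)) := by
  refine ⟨IsFractionRing.liftAlgHom (apolarInv_injective g), ?_, ?_⟩
  · exact (IsFractionRing.lift_algebraMap (apolarInv_injective g) _).trans (apolarLift_X_zero ..)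
  · exact (IsFractionRing.lift_algebraMap (apolarInv_injective g) _).trans (apolarLift_X_one ..)

variable {g}

theorem apolarK_comp_self {ι η : ApolarK g →ₐ[ℂ] ApolarK g}
    (hι : ι (ax g) = (ax g)⁻¹ ∧
      ι (ay g) = algebraMap ℂ (ApolarK g) Complex.I * ay g * ax g ^ (-(g + 1 : ℤ)))
    (hη : η (ax g) = ax g ∧ η (ay g) = -ay g) : ι.comp ι = η := by
  apply ApolarK.algHom_ext
  · simp [hι.1, hη.1]
  · have hz := zpow_ne_zero (-(g + 1 : ℤ)) (ax_ne_zero g)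
    simp only [AlgHom.comp_apply, hι.2, hη.2, map_mul, map_zpow₀, hι.1, AlgHom.commutes, inv_zpow]
    field_simp
    rw [algebraMap_I_sq]
    ring

end

/-- For every `g ≥ 1`, there is a unique `ℂ`-algebra automorphism `ι` of `K` with
`ι(x) = x⁻¹` and `ι(y) = i·y·x^(−(g+1))`, there is a unique `ℂ`-algebra automorphism `η`
of `K` with `η(x) = x` and `η(y) = −y` (the hyperelliptic involution), and `ι ∘ ι = η`. -/
theorem apolar_extra_automorphism (g : ℕ) (hg : 1 ≤ g) [IsDomain (ApolarA g)] :
    (∃! ι : ApolarK g ≃ₐ[ℂ] ApolarK g,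
        ι (ax g) = (ax g)⁻¹ ∧
          ι (ay g) = algebraMap ℂ (ApolarK g) Complex.I * ay g * ax g ^ (-(g + 1 : ℤ))) ∧
    (∃! η : ApolarK g ≃ₐ[ℂ] ApolarK g, η (ax g) = ax g ∧ η (ay g) = -ay g) ∧
    (∀ ι η : ApolarK g ≃ₐ[ℂ] ApolarK g,
        (ι (ax g) = (ax g)⁻¹ ∧
          ι (ay g) = algebraMap ℂ (ApolarK g) Complex.I * ay g * ax g ^ (-(g + 1 : ℤ))) →
        (η (ax g) = ax g ∧ η (ay g) = -ay g) →
        ∀ z : ApolarK g, ι (ι z) = η z) := by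
  obtain ⟨η, hη⟩ := exists_apolarK_neg g
  obtain ⟨ι, hι⟩ := exists_apolarK_inv g
  have hηη := apolarK_neg_comp_self hη
  have hιι := apolarK_comp_self hι hη
  refine ⟨⟨AlgEquiv.ofAlgHom ι (ι.comp η) ?_ ?_, hι, fun e he ↦ ?_⟩,
    ⟨AlgEquiv.ofAlgHom η η hηη hηη, hη, fun e he ↦ ?_⟩, fun e₁ e₂ h₁ h₂ z ↦ ?_⟩
  · rw [← AlgHom.comp_assoc, hιι, hηη]
  · rw [← hιι, AlgHom.comp_assoc, AlgHom.comp_assoc, ← AlgHom.comp_assoc, hιι, hηη]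
  · exact ApolarK.algEquiv_ext (he.1.trans hι.1.symm) (he.2.trans hι.2.symm)
  · exact ApolarK.algEquiv_ext (he.1.trans hη.1.symm) (he.2.trans hη.2.symm)
  · exact DFunLike.congr_fun
      (apolarK_comp_self (ι := e₁.toAlgHom) (η := e₂.toAlgHom) h₁ h₂) z
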